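/- The 3-dimensional subspace A_Ico ⊂ H₃ is associative, and its SO(3)-stabiliser equals Ico, which is isomorphic to the alternating group A₅ (in particular it has order 60). -/

import Mathlib

noncomputable section

open MvPolynomial Matrix

/-- The polynomial ring `ℝ[x,y,z]`. -/
abbrev P3 := MvPolynomial (Fin 3) ℝ

/-- `SO(3)`, realised as a set of real 3×3 matrices. -/
def SO3 : Set (Matrix (Fin 3) (Fin 3) ℝ) := {A | A * Aᵀ = 1 ∧ A.det = 1}

/-- The substitution action of a matrix `A` on polynomials: `(A · p)(w) = p (A⁻¹ w)`,
i.e. the variable `Xᵢ` is replaced by `∑ⱼ (A⁻¹)ᵢⱼ Xⱼ`. -/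
def sAct (A : Matrix (Fin 3) (Fin 3) ℝ) (p : P3) : P3 :=
  aeval (fun i => ∑ j, A⁻¹ i j • (X j : P3)) p

/-- The Laplace operator on polynomials in three variables. -/
def lap : P3 →ₗ[ℝ] P3 :=
  ∑ i : Fin 3, ((pderiv i).toLinearMap ∘ₗ (pderiv i).toLinearMap)

/-- `H₃`: the space of harmonic homogeneous cubic polynomials in `x, y, z`. -/
def H3 : Submodule ℝ P3 :=
  homogeneousSubmodule (Fin 3) ℝ 3 ⊓ LinearMap.ker lap

/-- The orthonormal basis `e₁, …, e₇` of `H₃` (with `x = X 0`, `y = X 1`, `z = X 2`). -/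
def eH : Fin 7 → P3 :=
  ![(1 / 5 : ℝ) • (X 0 * (2 * X 0 ^ 2 - 3 * X 1 ^ 2 - 3 * X 2 ^ 2)),
    (Real.sqrt 6 / 10) • (X 2 * (4 * X 0 ^ 2 - X 1 ^ 2 - X 2 ^ 2)),
    (Real.sqrt 6 / 10) • (X 1 * (4 * X 0 ^ 2 - X 1 ^ 2 - X 2 ^ 2)),
    (2 * Real.sqrt 15 / 5) • (X 0 * X 1 * X 2),
    (Real.sqrt 15 / 5) • (X 0 * (X 1 ^ 2 - X 2 ^ 2)),
    (Real.sqrt 10 / 10) • (X 2 * (3 * X 1 ^ 2 - X 2 ^ 2)),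
    (Real.sqrt 10 / 10) • (X 1 * (X 1 ^ 2 - 3 * X 2 ^ 2))]

/-- The identification of `ℝ⁷` (coordinates) with `H₃`, via the basis `e₁, …, e₇`. -/
def iotaH (v : Fin 7 → ℝ) : P3 := ∑ i, v i • eH i

/-- The subset of `H₃` corresponding to a coordinate subspace `E ⊆ ℝ⁷`. -/
def polySet (E : Submodule ℝ (Fin 7 → ℝ)) : Set P3 := iotaH '' (E : Set (Fin 7 → ℝ))

/-- The inner product of `H₃` making `e₁, …, e₇` orthonormal, in coordinates. -/
def dot7 (u v : Fin 7 → ℝ) : ℝ := ∑ i, u i * v i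

/-- The 3×3 minor determinant `(eⁱ ∧ eʲ ∧ eᵏ) (u, v, w)`. -/
def triD (u v w : Fin 7 → ℝ) (i j k : Fin 7) : ℝ :=
  Matrix.det !![u i, u j, u k; v i, v j, v k; w i, w j, w k]

/-- The 3-form `φ₀ = e¹²³ + e¹⁴⁵ − e¹⁶⁷ + e²⁴⁶ + e²⁵⁷ + e³⁴⁷ − e³⁵⁶`, in coordinates
(indices shifted by one: `eᵢ = e (i-1)`). -/
def phi0 (u v w : Fin 7 → ℝ) : ℝ :=
  triD u v w 0 1 2 + triD u v w 0 3 4 - triD u v w 0 5 6 + triD u v w 1 3 5 +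
    triD u v w 1 4 6 + triD u v w 2 3 6 - triD u v w 2 4 5

/-- A 3-dimensional subspace `E` of `H₃` (in coordinates) is associative if it has an
orthonormal basis `(u, v, w)` with `φ₀ (u, v, w) = ±1`. -/
def IsAssocSubspace (E : Submodule ℝ (Fin 7 → ℝ)) : Prop :=
  ∃ u v w : Fin 7 → ℝ, u ∈ E ∧ v ∈ E ∧ w ∈ E ∧
    dot7 u u = 1 ∧ dot7 v v = 1 ∧ dot7 w w = 1 ∧
    dot7 u v = 0 ∧ dot7 u w = 0 ∧ dot7 v w = 0 ∧
    Submodule.span ℝ {u, v, w} = E ∧ (phi0 u v w = 1 ∨ phi0 u v w = -1)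

/-- The subspace `E ⊆ H₃` is invariant under the substitution action of `A`: `A · E = E`. -/
def InvUnder (A : Matrix (Fin 3) (Fin 3) ℝ) (E : Submodule ℝ (Fin 7 → ℝ)) : Prop :=
  sAct A '' polySet E = polySet E

/-- The `SO(3)`-stabiliser of a subspace `E ⊆ H₃`: `{A ∈ SO(3) | A · E = E}`. -/
def stabSO3 (E : Submodule ℝ (Fin 7 → ℝ)) : Set (Matrix (Fin 3) (Fin 3) ℝ) :=
  {A | A ∈ SO3 ∧ InvUnder A E}

/-- The subset `S` of a monoid is a subgroup isomorphic to the group `G`. -/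
def SetIsoGroup {M : Type*} [Monoid M] (S : Set M) (G : Type*) [Group G] : Prop :=
  ∃ f : G → M, Function.Injective f ∧ (∀ a b, f (a * b) = f a * f b) ∧ Set.range f = S

/-- The rotation `R_α` about the x-axis through the angle `α`. -/
def Rmat (α : ℝ) : Matrix (Fin 3) (Fin 3) ℝ :=
  !![1, 0, 0; 0, Real.cos α, -Real.sin α; 0, Real.sin α, Real.cos α]

/-- `A₁₂₃ = span (e₁, e₂, e₃)`, in coordinates. -/
def A123 : Submodule ℝ (Fin 7 → ℝ) :=
  Submodule.span ℝ {![1, 0, 0, 0, 0, 0, 0], ![0, 1, 0, 0, 0, 0, 0], ![0, 0, 1, 0, 0, 0, 0]}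

/-- `A₁₄₅ = span (e₁, e₄, e₅)`, in coordinates. -/
def A145 : Submodule ℝ (Fin 7 → ℝ) :=
  Submodule.span ℝ {![1, 0, 0, 0, 0, 0, 0], ![0, 0, 0, 1, 0, 0, 0], ![0, 0, 0, 0, 1, 0, 0]}

/-- `A₁₆₇ = span (e₁, e₆, e₇)`, in coordinates. -/
def A167 : Submodule ℝ (Fin 7 → ℝ) :=
  Submodule.span ℝ {![1, 0, 0, 0, 0, 0, 0], ![0, 0, 0, 0, 0, 1, 0], ![0, 0, 0, 0, 0, 0, 1]}

/-- The golden ratio `τ = (1+√5)/2`. -/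
def gtau : ℝ := (1 + Real.sqrt 5) / 2

/-- The icosahedral group `Ico ≅ A₅ ⊂ SO(3)`: the group (= multiplicative closure, as all
generators have finite order) generated by the three listed rotations. -/
def IcoSet : Set (Matrix (Fin 3) (Fin 3) ℝ) :=
  (Submonoid.closure {!![-1, 0, 0; 0, -1, 0; 0, 0, 1], !![0, 0, 1; 1, 0, 0; 0, 1, 0],
      (1 / 2 : ℝ) • !![1, -gtau, 1 / gtau; gtau, 1 / gtau, -1; 1 / gtau, 1, gtau]} :
    Submonoid (Matrix (Fin 3) (Fin 3) ℝ))

/-- `A_Ico`, in coordinates with respect to the basis `e₁, …, e₇`. -/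
def AIco : Submodule ℝ (Fin 7 → ℝ) :=
  Submodule.span ℝ
    {![1, 0, 0, 0, Real.sqrt 3, 0, 0],
      ![0, Real.sqrt 3 * (Real.sqrt 5 - 1), 0, 0, 0, -(3 + Real.sqrt 5), 0],
      ![0, 0, Real.sqrt 3 * (1 + Real.sqrt 5), 0, 0, 0, 3 - Real.sqrt 5]}

/-- `C = span (e₄, √3e₁−e₅, (3+√5)e₂+√3(√5−1)e₆, (√5−3)e₃+√3(1+√5)e₇)`, in coordinates. -/
def Cico : Submodule ℝ (Fin 7 → ℝ) :=
  Submodule.span ℝ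
    {![0, 0, 0, 1, 0, 0, 0],
      ![Real.sqrt 3, 0, 0, 0, -1, 0, 0],
      ![0, 3 + Real.sqrt 5, 0, 0, 0, Real.sqrt 3 * (Real.sqrt 5 - 1), 0],
      ![0, 0, Real.sqrt 5 - 3, 0, 0, 0, Real.sqrt 3 * (1 + Real.sqrt 5)]}

/-- The 12 vertices `(0, ±τ, ±1), (±1, 0, ±τ), (±τ, ±1, 0)` of the icosahedron. -/
def IcoVerts : Set (Fin 3 → ℝ) :=
  {u | ∃ s t : ℝ, (s = 1 ∨ s = -1) ∧ (t = 1 ∨ t = -1) ∧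
    (u = ![0, s * gtau, t] ∨ u = ![s, 0, t * gtau] ∨ u = ![s * gtau, t, 0])}

lemma gtau_sq : gtau ^ 2 = gtau + 1 := by
  have h : Real.sqrt 5 ^ 2 = 5 := Real.sq_sqrt (by norm_num)
  unfold gtau
  linear_combination h / 4

lemma gtau_pos : 0 < gtau := by
  unfold gtau
  positivity

lemma one_div_gtau : 1 / gtau = gtau - 1 := by
  rw [div_eq_iff gtau_pos.ne']
  linear_combination -gtau_sq

lemma one_lt_gtau : 1 < gtau := by
  have := gtau_sq
  have := gtau_pos
  nlinarith

lemma sqrt_five_eq : Real.sqrt 5 = 2 * gtau - 1 := by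
  unfold gtau
  ring

/-- Three cubics spanning `A_Ico`, as a map `ℝ³ → ℝ³`. -/
def icoCubics (w : Fin 3 → ℝ) : Fin 3 → ℝ :=
  ![w 0 * (w 0 ^ 2 + 3 * (gtau - 1) * w 1 ^ 2 - 3 * gtau * w 2 ^ 2),
    w 1 * (w 1 ^ 2 + 3 * (gtau - 1) * w 2 ^ 2 - 3 * gtau * w 0 ^ 2),
    w 2 * (w 2 ^ 2 + 3 * (gtau - 1) * w 0 ^ 2 - 3 * gtau * w 1 ^ 2)]

lemma eval_iotaH_span (a b c : ℝ) (w : Fin 3 → ℝ) :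
    eval w (iotaH (a • ![1, 0, 0, 0, Real.sqrt 3, 0, 0] +
      b • ![0, Real.sqrt 3 * (Real.sqrt 5 - 1), 0, 0, 0, -(3 + Real.sqrt 5), 0] +
      c • ![0, 0, Real.sqrt 3 * (1 + Real.sqrt 5), 0, 0, 0, 3 - Real.sqrt 5])) =
    ![2 / 5 * a, -(4 * Real.sqrt 2 / 5) * c, 4 * Real.sqrt 2 / 5 * b] ⬝ᵥ icoCubics w := by
  have h3 : Real.sqrt 3 ^ 2 = 3 := Real.sq_sqrt (by norm_num)
  have h6 : Real.sqrt 6 = Real.sqrt 2 * Real.sqrt 3 := by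
    rw [← Real.sqrt_mul (by norm_num)]; norm_num
  have h10 : Real.sqrt 10 = Real.sqrt 2 * Real.sqrt 5 := by
    rw [← Real.sqrt_mul (by norm_num)]; norm_num
  have h15 : Real.sqrt 15 = Real.sqrt 3 * Real.sqrt 5 := by
    rw [← Real.sqrt_mul (by norm_num)]; norm_num
  have ht := gtau_sq
  simp [iotaH, eH, Fin.sum_univ_succ, icoCubics, dotProduct, h6, h10, h15, sqrt_five_eq, smul_eval]
  generalize Real.sqrt 3 = r3 at *
  generalize Real.sqrt 2 = r2 at *
  generalize gtau = t at *
  grind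

lemma exists_mem_polySet_eval (c : Fin 3 → ℝ) :
    ∃ p ∈ polySet AIco, ∀ w, eval w p = c ⬝ᵥ icoCubics w := by
  have h2 : Real.sqrt 2 ≠ 0 := by positivity
  refine ⟨_, ⟨_, Submodule.mem_span_triple.2
    ⟨5 / 2 * c 0, 5 / (4 * Real.sqrt 2) * c 2, -(5 / (4 * Real.sqrt 2)) * c 1, rfl⟩, rfl⟩,
    fun w => ?_⟩
  rw [eval_iotaH_span]
  congr 1
  ext i
  fin_cases i <;> simp <;> field_simp

lemma mem_polySet_AIco {p : P3} :
    p ∈ polySet AIco ↔ ∃ c : Fin 3 → ℝ, ∀ w, eval w p = c ⬝ᵥ icoCubics w := by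
  constructor
  · rintro ⟨v, hv, rfl⟩
    obtain ⟨a, b, c, rfl⟩ := Submodule.mem_span_triple.1 hv
    exact ⟨_, eval_iotaH_span a b c⟩
  · rintro ⟨c, hc⟩
    obtain ⟨q, hq, hqc⟩ := exists_mem_polySet_eval c
    rwa [MvPolynomial.funext fun w => (hc w).trans (hqc w).symm]

lemma eval_sAct (A : Matrix (Fin 3) (Fin 3) ℝ) (p : P3) (w : Fin 3 → ℝ) :
    eval w (sAct A p) = eval (A⁻¹ *ᵥ w) p := by
  have : ((aeval w).comp (aeval fun i => ∑ j, A⁻¹ i j • (X j : P3)) : P3 →ₐ[ℝ] ℝ) =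
      aeval (A⁻¹ *ᵥ w) := by
    ext i
    simp [mulVec, dotProduct, map_sum]
  have h := DFunLike.congr_fun this p
  simpa [aeval_eq_eval, sAct] using h

lemma SO3.transpose_mul_self {A : Matrix (Fin 3) (Fin 3) ℝ} (hA : A ∈ SO3) : Aᵀ * A = 1 :=
  mul_eq_one_comm.1 hA.1

lemma SO3.inv_eq_transpose {A : Matrix (Fin 3) (Fin 3) ℝ} (hA : A ∈ SO3) : A⁻¹ = Aᵀ :=
  Matrix.inv_eq_right_inv hA.1

lemma SO3.transpose_mem {A : Matrix (Fin 3) (Fin 3) ℝ} (hA : A ∈ SO3) : Aᵀ ∈ SO3 :=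
  ⟨by rw [transpose_transpose, SO3.transpose_mul_self hA], by rw [det_transpose, hA.2]⟩

lemma SO3.mul_mem {A B : Matrix (Fin 3) (Fin 3) ℝ} (hA : A ∈ SO3) (hB : B ∈ SO3) :
    A * B ∈ SO3 := by
  refine ⟨?_, by rw [det_mul, hA.2, hB.2, one_mul]⟩
  rw [transpose_mul, mul_assoc, ← mul_assoc B, hB.1, one_mul, hA.1]

/-- `A` permutes the span of the three cubics by pullback. -/
def PullsBack (A : Matrix (Fin 3) (Fin 3) ℝ) : Prop :=
  ∃ M : Matrix (Fin 3) (Fin 3) ℝ, ∀ w, icoCubics (A *ᵥ w) = M *ᵥ icoCubics w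

lemma PullsBack.of_dotProduct {A : Matrix (Fin 3) (Fin 3) ℝ}
    (h : ∀ c : Fin 3 → ℝ, ∃ c' : Fin 3 → ℝ, ∀ w,
      c ⬝ᵥ icoCubics (A *ᵥ w) = c' ⬝ᵥ icoCubics w) : PullsBack A := by
  choose f hf using h
  refine ⟨Matrix.of fun i => f (Pi.single i 1), fun w => ?_⟩
  ext i
  simpa [mulVec] using hf (Pi.single i 1) w

lemma PullsBack.mul {A B : Matrix (Fin 3) (Fin 3) ℝ} (hA : PullsBack A) (hB : PullsBack B) :
    PullsBack (A * B) := by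
  obtain ⟨M, hM⟩ := hA
  obtain ⟨N, hN⟩ := hB
  exact ⟨M * N, fun w => by rw [← mulVec_mulVec, hM, hN, mulVec_mulVec]⟩

lemma PullsBack.sAct_mem {A : Matrix (Fin 3) (Fin 3) ℝ} (hA : PullsBack A⁻¹) {p : P3}
    (hp : p ∈ polySet AIco) : sAct A p ∈ polySet AIco := by
  obtain ⟨M, hM⟩ := hA
  obtain ⟨c, hc⟩ := mem_polySet_AIco.1 hp
  refine mem_polySet_AIco.2 ⟨c ᵥ* M, fun w => ?_⟩
  rw [eval_sAct, hc, hM, dotProduct_mulVec]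

lemma mem_stabSO3_AIco {A : Matrix (Fin 3) (Fin 3) ℝ} :
    A ∈ stabSO3 AIco ↔ A ∈ SO3 ∧ PullsBack A ∧ PullsBack Aᵀ := by
  constructor
  · rintro ⟨hA, hE⟩
    refine ⟨hA, .of_dotProduct fun c => ?_, .of_dotProduct fun c => ?_⟩
    · obtain ⟨p, hp, hc⟩ := exists_mem_polySet_eval c
      rw [← hE] at hp
      obtain ⟨q, hq, rfl⟩ := hp
      obtain ⟨c', hc'⟩ := mem_polySet_AIco.1 hq
      refine ⟨c', fun w => ?_⟩
      rw [← hc, eval_sAct, SO3.inv_eq_transpose hA, mulVec_mulVec, SO3.transpose_mul_self hA,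
        one_mulVec, hc']
    · obtain ⟨p, hp, hc⟩ := exists_mem_polySet_eval c
      obtain ⟨c', hc'⟩ := mem_polySet_AIco.1 (hE.subset ⟨p, hp, rfl⟩)
      refine ⟨c', fun w => ?_⟩
      rw [← hc, ← hc', eval_sAct, SO3.inv_eq_transpose hA]
  · rintro ⟨hA, h1, h2⟩
    refine ⟨hA, Set.Subset.antisymm ?_ fun p hp => ?_⟩
    · rintro _ ⟨p, hp, rfl⟩
      exact PullsBack.sAct_mem (by rwa [SO3.inv_eq_transpose hA]) hp
    · refine ⟨sAct Aᵀ p, PullsBack.sAct_mem ?_ hp, MvPolynomial.funext fun w => ?_⟩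
      · rwa [SO3.inv_eq_transpose (SO3.transpose_mem hA), transpose_transpose]
      · rw [eval_sAct, eval_sAct, SO3.inv_eq_transpose hA,
          SO3.inv_eq_transpose (SO3.transpose_mem hA), transpose_transpose, mulVec_mulVec,
          hA.1, one_mulVec]

lemma isAssocSubspace_AIco : IsAssocSubspace AIco := by
  have h3 : Real.sqrt 3 ^ 2 = 3 := Real.sq_sqrt (by norm_num)
  have h5 : Real.sqrt 5 ^ 2 = 5 := Real.sq_sqrt (by norm_num)
  have h2 : Real.sqrt 2 ^ 2 = 2 := Real.sq_sqrt (by norm_num)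
  have h2' : Real.sqrt 2 ≠ 0 := by positivity
  have e : ∀ v : Fin 7 → ℝ, v ∈ ({![1, 0, 0, 0, Real.sqrt 3, 0, 0],
      ![0, Real.sqrt 3 * (Real.sqrt 5 - 1), 0, 0, 0, -(3 + Real.sqrt 5), 0],
      ![0, 0, Real.sqrt 3 * (1 + Real.sqrt 5), 0, 0, 0, 3 - Real.sqrt 5]} : Set (Fin 7 → ℝ)) →
      v ∈ AIco := fun v hv => Submodule.subset_span hv
  refine ⟨(1 / 2 : ℝ) • ![1, 0, 0, 0, Real.sqrt 3, 0, 0],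
    (Real.sqrt 2 / 8) • ![0, Real.sqrt 3 * (Real.sqrt 5 - 1), 0, 0, 0, -(3 + Real.sqrt 5), 0],
    (Real.sqrt 2 / 8) • ![0, 0, Real.sqrt 3 * (1 + Real.sqrt 5), 0, 0, 0, 3 - Real.sqrt 5],
    AIco.smul_mem _ (e _ (by simp)), AIco.smul_mem _ (e _ (by simp)),
    AIco.smul_mem _ (e _ (by simp)), ?_, ?_, ?_, ?_, ?_, ?_, ?_, .inl ?_⟩
  · simp [dot7, Fin.sum_univ_succ]; grind
  · simp [dot7, Fin.sum_univ_succ]; grind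
  · simp [dot7, Fin.sum_univ_succ]; grind
  · simp [dot7, Fin.sum_univ_succ]
  · simp [dot7, Fin.sum_univ_succ]
  · simp [dot7, Fin.sum_univ_succ]
  · refine le_antisymm (Submodule.span_le.2 ?_) (Submodule.span_le.2 ?_)
    · rintro v (rfl | rfl | rfl) <;> exact AIco.smul_mem _ (e _ (by simp))
    · rintro v (rfl | rfl | rfl)
      · refine (Submodule.smul_mem_iff _ (s := (1 / 2 : ℝ)) (by norm_num)).1
          (Submodule.subset_span (by simp))
      · refine (Submodule.smul_mem_iff _ (s := Real.sqrt 2 / 8) (by positivity)).1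
          (Submodule.subset_span (by simp))
      · refine (Submodule.smul_mem_iff _ (s := Real.sqrt 2 / 8) (by positivity)).1
          (Submodule.subset_span (by simp))
  · simp [phi0, triD, det_fin_three]
    grind

lemma transpose_mem_stabSO3_AIco {A : Matrix (Fin 3) (Fin 3) ℝ} (hA : A ∈ stabSO3 AIco) :
    Aᵀ ∈ stabSO3 AIco := by
  obtain ⟨h, h1, h2⟩ := mem_stabSO3_AIco.1 hA
  exact mem_stabSO3_AIco.2 ⟨SO3.transpose_mem h, h2, by rwa [transpose_transpose]⟩

lemma mul_mem_stabSO3_AIco {A B : Matrix (Fin 3) (Fin 3) ℝ} (hA : A ∈ stabSO3 AIco)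
    (hB : B ∈ stabSO3 AIco) : A * B ∈ stabSO3 AIco := by
  obtain ⟨h, h1, h2⟩ := mem_stabSO3_AIco.1 hA
  obtain ⟨k, k1, k2⟩ := mem_stabSO3_AIco.1 hB
  exact mem_stabSO3_AIco.2 ⟨SO3.mul_mem h k, h1.mul k1, by rw [transpose_mul]; exact k2.mul h2⟩

/-- The half-turn about the `z`-axis. -/
def icoHalfTurn : Matrix (Fin 3) (Fin 3) ℝ := !![-1, 0, 0; 0, -1, 0; 0, 0, 1]

/-- The cyclic permutation of the coordinates. -/
def icoCycle : Matrix (Fin 3) (Fin 3) ℝ := !![0, 0, 1; 1, 0, 0; 0, 1, 0]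

/-- The generator of `Ico` of order five, with axis through `(1, 0, τ)`. -/
def icoQuintic : Matrix (Fin 3) (Fin 3) ℝ :=
  (1 / 2 : ℝ) • !![1, -gtau, 1 / gtau; gtau, 1 / gtau, -1; 1 / gtau, 1, gtau]

lemma icoQuintic_eq : icoQuintic =
    (1 / 2 : ℝ) • !![1, -gtau, gtau - 1; gtau, gtau - 1, -1; gtau - 1, 1, gtau] := by
  rw [icoQuintic, one_div_gtau]

/-- The icosahedral group as a submonoid. -/
def icoSubmonoid : Submonoid (Matrix (Fin 3) (Fin 3) ℝ) :=
  Submonoid.closure {icoHalfTurn, icoCycle, icoQuintic}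

lemma coe_icoSubmonoid : (icoSubmonoid : Set (Matrix (Fin 3) (Fin 3) ℝ)) = IcoSet := rfl

lemma icoHalfTurn_mem : icoHalfTurn ∈ icoSubmonoid := Submonoid.subset_closure (by simp)

lemma icoCycle_mem : icoCycle ∈ icoSubmonoid := Submonoid.subset_closure (by simp)

lemma icoQuintic_mem : icoQuintic ∈ icoSubmonoid := Submonoid.subset_closure (by simp)

lemma icoHalfTurn_mem_stab : icoHalfTurn ∈ stabSO3 AIco := by
  have ht : icoHalfTurnᵀ = icoHalfTurn := by
    ext i j; fin_cases i <;> fin_cases j <;> simp [icoHalfTurn]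
  have hp : PullsBack icoHalfTurn := by
    refine ⟨icoHalfTurn, fun w => ?_⟩
    ext i
    fin_cases i <;> simp [icoHalfTurn, icoCubics, mulVec, dotProduct, Fin.sum_univ_three]
  refine mem_stabSO3_AIco.2 ⟨⟨?_, ?_⟩, hp, by rwa [ht]⟩
  · rw [ht]
    ext i j; fin_cases i <;> fin_cases j <;> simp [icoHalfTurn]
  · simp [icoHalfTurn, det_fin_three]

lemma icoCycle_mem_stab : icoCycle ∈ stabSO3 AIco := by
  refine mem_stabSO3_AIco.2 ⟨⟨?_, ?_⟩, ⟨icoCycle, fun w => ?_⟩, ⟨icoCycleᵀ, fun w => ?_⟩⟩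
  · ext i j; fin_cases i <;> fin_cases j <;>
      simp [icoCycle, Matrix.mul_apply, Fin.sum_univ_three]
  · simp [icoCycle, det_fin_three]
  · ext i
    fin_cases i <;> simp [icoCycle, icoCubics, mulVec, dotProduct, Fin.sum_univ_three]
  · ext i
    fin_cases i <;> simp [icoCycle, icoCubics, mulVec, dotProduct, Fin.sum_univ_three]

lemma icoQuintic_mem_stab : icoQuintic ∈ stabSO3 AIco := by
  have ht := gtau_sq
  refine mem_stabSO3_AIco.2 ⟨⟨?_, ?_⟩,
    ⟨(1 / 2 : ℝ) • !![1, gtau - 1, -gtau; -(gtau - 1), -gtau, -1; -gtau, 1, -(gtau - 1)],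
      fun w => ?_⟩,
    ⟨(1 / 2 : ℝ) • !![1, -(gtau - 1), -gtau; gtau - 1, -gtau, 1; -gtau, -1, -(gtau - 1)],
      fun w => ?_⟩⟩ <;> rw [icoQuintic_eq]
  · ext i j
    fin_cases i <;> fin_cases j <;>
      simp [Matrix.mul_apply, Fin.sum_univ_three] <;> grind
  · simp [det_fin_three]; grind
  · ext i
    fin_cases i <;> simp [icoCubics, mulVec, dotProduct, Fin.sum_univ_three] <;>
      grind
  · ext i
    fin_cases i <;> simp [icoCubics, mulVec, dotProduct, Fin.sum_univ_three] <;>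
      grind

lemma icoSubmonoid_subset_stab {A : Matrix (Fin 3) (Fin 3) ℝ} (hA : A ∈ icoSubmonoid) :
    A ∈ stabSO3 AIco := by
  induction hA using Submonoid.closure_induction with
  | mem A h =>
    rcases h with rfl | rfl | rfl
    exacts [icoHalfTurn_mem_stab, icoCycle_mem_stab, icoQuintic_mem_stab]
  | one =>
    exact mem_stabSO3_AIco.2 ⟨⟨by simp, by simp⟩, ⟨1, by simp⟩, ⟨1, by simp⟩⟩
  | mul A B _ _ hA hB => exact mul_mem_stabSO3_AIco hA hB

/-- `v` is a critical point of every cubic in `A_Ico` restricted to a sphere. -/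
def IsIcoCritical (v : Fin 3 → ℝ) : Prop :=
  ∀ u : Fin 3 → ℝ, u ⬝ᵥ v = 0 → icoCubics (v + u) = icoCubics (v - u) + 2 • icoCubics u

lemma IsIcoCritical.mulVec {A : Matrix (Fin 3) (Fin 3) ℝ} (hA : A ∈ stabSO3 AIco)
    {v : Fin 3 → ℝ} (hv : IsIcoCritical v) : IsIcoCritical (A *ᵥ v) := by
  obtain ⟨h, ⟨M, hM⟩, -⟩ := mem_stabSO3_AIco.1 hA
  intro u hu
  have hu' : A *ᵥ (Aᵀ *ᵥ u) = u := by rw [mulVec_mulVec, h.1, one_mulVec]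
  have := hv (Aᵀ *ᵥ u) (by rw [mulVec_transpose, ← dotProduct_mulVec, hu])
  rw [← hu', ← mulVec_add, ← mulVec_sub, hM, hM, hM, this, mulVec_add, mulVec_smul]

lemma isIcoCritical_of_mem {v : Fin 3 → ℝ} (hv : v ∈ IcoVerts) : IsIcoCritical v := by
  have ht := gtau_sq
  intro u hu
  obtain ⟨s, t, hs, ht', rfl | rfl | rfl⟩ := hv <;>
  · simp [dotProduct, Fin.sum_univ_three] at hu
    ext i
    fin_cases i <;> simp [icoCubics] <;> grind

lemma dotProduct_self_of_mem_icoVerts {v : Fin 3 → ℝ} (hv : v ∈ IcoVerts) :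
    v ⬝ᵥ v = 1 + gtau ^ 2 := by
  obtain ⟨s, t, rfl | rfl, rfl | rfl, rfl | rfl | rfl⟩ := hv <;>
    simp [dotProduct, Fin.sum_univ_three] <;> ring

lemma sq_eq_of_golden_ratio {y z : ℝ} (h : (gtau - 1) * y ^ 2 = gtau * z ^ 2)
    (hn : y ^ 2 + z ^ 2 = 1 + gtau ^ 2) :
    ∃ s t : ℝ, (s = 1 ∨ s = -1) ∧ (t = 1 ∨ t = -1) ∧ y = s * gtau ∧ z = t := by
  have ht := gtau_sq
  have hp := gtau_pos
  have hz : z ^ 2 = 1 := by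
    have : (2 * gtau - 1) * (z ^ 2 - 1) = 0 := by grind
    have h1 := one_lt_gtau
    rcases mul_eq_zero.1 this with h | h <;> linarith
  have hy : (y - gtau) * (y + gtau) = 0 := by linarith
  refine ⟨y / gtau, z, ?_, by grind, by field_simp, rfl⟩
  rcases mul_eq_zero.1 hy with h | h
  · left; rw [div_eq_one_iff_eq hp.ne']; linarith
  · right; rw [div_eq_iff hp.ne']; linarith

lemma mem_icoVerts_of_isIcoCritical {v : Fin 3 → ℝ} (hv : IsIcoCritical v)
    (hn : v ⬝ᵥ v = 1 + gtau ^ 2) : v ∈ IcoVerts := by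
  have ht := gtau_sq
  have h1 := hv ![0, -v 2, v 1] (by simp [dotProduct, Fin.sum_univ_three]; ring)
  have h2 := hv ![v 2, 0, -v 0] (by simp [dotProduct, Fin.sum_univ_three]; ring)
  have h3 := hv ![-v 1, v 0, 0] (by simp [dotProduct, Fin.sum_univ_three]; ring)
  have hxyz : (2 * gtau - 1) * (v 0 * v 1 * v 2) = 0 := by
    have := congrFun h1 0
    simp [icoCubics, -mul_eq_mul_left_iff] at this
    linear_combination (-1 / 12) * this
  have hx : v 0 = 0 → (v 1 ^ 2 + v 2 ^ 2) * ((gtau - 1) * v 1 ^ 2 - gtau * v 2 ^ 2) = 0 := by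
    intro h
    have e := congrFun h2 0
    have f := congrFun h3 0
    simp [icoCubics, h] at e f
    linear_combination (v 2 / 6) * e - (v 1 / 6) * f
  have hy : v 1 = 0 → (v 2 ^ 2 + v 0 ^ 2) * ((gtau - 1) * v 2 ^ 2 - gtau * v 0 ^ 2) = 0 := by
    intro h
    have e := congrFun h1 1
    have f := congrFun h3 1
    simp [icoCubics, h] at e f
    linear_combination (v 0 / 6) * f - (v 2 / 6) * e
  have hz : v 2 = 0 → (v 0 ^ 2 + v 1 ^ 2) * ((gtau - 1) * v 0 ^ 2 - gtau * v 1 ^ 2) = 0 := by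
    intro h
    have e := congrFun h1 2
    have f := congrFun h2 2
    simp [icoCubics, h] at e f
    linear_combination (v 1 / 6) * e - (v 0 / 6) * f
  simp only [dotProduct, Fin.sum_univ_three] at hn
  have hne : 1 + gtau ^ 2 ≠ 0 := by positivity
  have h1t := one_lt_gtau
  have hτ : 2 * gtau - 1 ≠ 0 := by linarith
  have hv3 : v = ![v 0, v 1, v 2] := by ext i; fin_cases i <;> rfl
  rcases mul_eq_zero.1 ((mul_eq_zero.1 hxyz).resolve_left hτ) with h | h
  · rcases mul_eq_zero.1 h with h | h
    · have hn' : v 1 ^ 2 + v 2 ^ 2 = 1 + gtau ^ 2 := by rw [← hn, h]; ring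
      have hK := (mul_eq_zero.1 (hx h)).resolve_left (hn' ▸ hne)
      obtain ⟨s, t, hs, ht, h1, h2⟩ := sq_eq_of_golden_ratio (sub_eq_zero.1 hK) hn'
      exact ⟨s, t, hs, ht, .inl (by rw [hv3, h, h1, h2])⟩
    · have hn' : v 2 ^ 2 + v 0 ^ 2 = 1 + gtau ^ 2 := by rw [← hn, h]; ring
      have hK := (mul_eq_zero.1 (hy h)).resolve_left (hn' ▸ hne)
      obtain ⟨s, t, hs, ht, h1, h2⟩ := sq_eq_of_golden_ratio (sub_eq_zero.1 hK) hn'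
      exact ⟨t, s, ht, hs, .inr (.inl (by rw [hv3, h, h1, h2]))⟩
  · have hn' : v 0 ^ 2 + v 1 ^ 2 = 1 + gtau ^ 2 := by rw [← hn, h]; ring
    have hK := (mul_eq_zero.1 (hz h)).resolve_left (hn' ▸ hne)
    obtain ⟨s, t, hs, ht, h1, h2⟩ := sq_eq_of_golden_ratio (sub_eq_zero.1 hK) hn'
    exact ⟨s, t, hs, ht, .inr (.inr (by rw [hv3, h, h1, h2]))⟩

lemma SO3.dotProduct_mulVec_mulVec {A : Matrix (Fin 3) (Fin 3) ℝ} (hA : A ∈ SO3)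
    (u v : Fin 3 → ℝ) : (A *ᵥ u) ⬝ᵥ (A *ᵥ v) = u ⬝ᵥ v := by
  rw [dotProduct_mulVec, ← mulVec_transpose, mulVec_mulVec, SO3.transpose_mul_self hA,
    one_mulVec]

lemma mulVec_mem_icoVerts {A : Matrix (Fin 3) (Fin 3) ℝ} (hA : A ∈ stabSO3 AIco)
    {v : Fin 3 → ℝ} (hv : v ∈ IcoVerts) : A *ᵥ v ∈ IcoVerts := by
  refine mem_icoVerts_of_isIcoCritical ((isIcoCritical_of_mem hv).mulVec hA) ?_
  rw [SO3.dotProduct_mulVec_mulVec hA.1, dotProduct_self_of_mem_icoVerts hv]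

lemma SO3.adjugate_eq_transpose {A : Matrix (Fin 3) (Fin 3) ℝ} (hA : A ∈ SO3) :
    A.adjugate = Aᵀ := by
  rw [← one_mul A.adjugate, ← SO3.transpose_mul_self hA, mul_assoc, mul_adjugate, hA.2,
    one_smul, mul_one]

lemma SO3.cross_mulVec {A : Matrix (Fin 3) (Fin 3) ℝ} (hA : A ∈ SO3) (u v : Fin 3 → ℝ) :
    (A *ᵥ u) ⨯₃ (A *ᵥ v) = A *ᵥ (u ⨯₃ v) := by
  have h : Aᵀ.adjugate = A := by
    rw [SO3.adjugate_eq_transpose (SO3.transpose_mem hA), transpose_transpose]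
  rw [adjugate_fin_three] at h
  conv_rhs => rw [← h]
  ext i
  fin_cases i <;>
    simp [cross_apply, mulVec, dotProduct, Fin.sum_univ_three] <;> ring

/-- A rotation is determined by its values on a pair of adjacent vertices. -/
lemma SO3.ext_of_adjacent {A B : Matrix (Fin 3) (Fin 3) ℝ} (hA : A ∈ SO3) (hB : B ∈ SO3)
    (h0 : A *ᵥ ![1, 0, gtau] = B *ᵥ ![1, 0, gtau])
    (h1 : A *ᵥ ![gtau, 1, 0] = B *ᵥ ![gtau, 1, 0]) : A = B := by
  have ht := gtau_sq
  have hp := gtau_pos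
  have h2 : A *ᵥ (![1, 0, gtau] ⨯₃ ![gtau, 1, 0]) = B *ᵥ (![1, 0, gtau] ⨯₃ ![gtau, 1, 0]) := by
    rw [← SO3.cross_mulVec hA, ← SO3.cross_mulVec hB, h0, h1]
  have hP : A * !![1, gtau, -gtau; 0, 1, gtau ^ 2; gtau, 0, 1] =
      B * !![1, gtau, -gtau; 0, 1, gtau ^ 2; gtau, 0, 1] := by
    ext i j
    have e0 := congrFun h0 i
    have e1 := congrFun h1 i
    have e2 := congrFun h2 i
    simp [cross_apply, mulVec, dotProduct, Fin.sum_univ_three] at e0 e1 e2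
    fin_cases j <;> simp [Matrix.mul_apply, Fin.sum_univ_three]
    · linear_combination e0
    · linear_combination e1
    · linear_combination e2
  have hdet : IsUnit (!![1, gtau, -gtau; 0, 1, gtau ^ 2; gtau, 0, 1] : Matrix _ _ ℝ).det := by
    rw [isUnit_iff_ne_zero]
    simp [det_fin_three]
    positivity
  exact (isUnit_iff_isUnit_det _ |>.2 hdet).mul_left_injective hP

lemma icoHalfTurn_mulVec (x y z : ℝ) : icoHalfTurn *ᵥ ![x, y, z] = ![-x, -y, z] := by
  ext i; fin_cases i <;> simp [icoHalfTurn]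

lemma icoCycle_mulVec (x y z : ℝ) : icoCycle *ᵥ ![x, y, z] = ![z, x, y] := by
  ext i; fin_cases i <;> simp [icoCycle]

lemma icoQuintic_mulVec (x y z : ℝ) : icoQuintic *ᵥ ![x, y, z] =
    ![(x - gtau * y + (gtau - 1) * z) / 2, (gtau * x + (gtau - 1) * y - z) / 2,
      ((gtau - 1) * x + y + gtau * z) / 2] := by
  rw [icoQuintic_eq]
  ext i; fin_cases i <;> simp <;> ring

lemma exists_mem_icoSubmonoid_mulVec_eq {v : Fin 3 → ℝ} (hv : v ∈ IcoVerts) :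
    ∃ h ∈ icoSubmonoid, h *ᵥ ![1, 0, gtau] = v := by
  have hH := icoHalfTurn_mem
  have hC := icoCycle_mem
  have hK := mul_mem hC (mul_mem hH (mul_mem hC hC))
  have key : ∀ s t : ℝ, (s = 1 ∨ s = -1) → (t = 1 ∨ t = -1) →
      ∃ h ∈ icoSubmonoid, h *ᵥ ![1, 0, gtau] = ![s, 0, t * gtau] := by
    rintro s t (rfl | rfl) (rfl | rfl)
    · exact ⟨1, one_mem _, by simp⟩
    · exact ⟨_, hK, by simp [← mulVec_mulVec, icoHalfTurn_mulVec, icoCycle_mulVec]⟩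
    · exact ⟨_, hH, by simp [icoHalfTurn_mulVec]⟩
    · exact ⟨_, mul_mem hH hK,
        by simp [← mulVec_mulVec, icoHalfTurn_mulVec, icoCycle_mulVec]⟩
  obtain ⟨s, t, hs, ht, rfl | rfl | rfl⟩ := hv
  · obtain ⟨h, hh, e⟩ := key t s ht hs
    exact ⟨_, mul_mem hC (mul_mem hC hh), by simp [← mulVec_mulVec, e, icoCycle_mulVec]⟩
  · exact key s t hs ht
  · obtain ⟨h, hh, e⟩ := key t s ht hs
    exact ⟨_, mul_mem hC hh, by simp [← mulVec_mulVec, e, icoCycle_mulVec]⟩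

lemma exists_mem_icoSubmonoid_mulVec_adjacent {u : Fin 3 → ℝ} (hu : u ∈ IcoVerts)
    (hd : u ⬝ᵥ ![1, 0, gtau] = gtau) :
    ∃ g ∈ icoSubmonoid, g *ᵥ ![1, 0, gtau] = ![1, 0, gtau] ∧ g *ᵥ ![gtau, 1, 0] = u := by
  have ht := gtau_sq
  have h1 := one_lt_gtau
  have hQ0 : icoQuintic *ᵥ ![1, 0, gtau] = ![1, 0, gtau] := by
    rw [icoQuintic_mulVec]; ext i; fin_cases i <;> simp <;> grind
  have hQ1 : icoQuintic *ᵥ ![gtau, 1, 0] = ![0, gtau, 1] := by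
    rw [icoQuintic_mulVec]; ext i; fin_cases i <;> simp <;> grind
  have hQ2 : icoQuintic *ᵥ ![0, gtau, 1] = ![-1, 0, gtau] := by
    rw [icoQuintic_mulVec]; ext i; fin_cases i <;> simp <;> grind
  have hQ3 : icoQuintic *ᵥ ![-1, 0, gtau] = ![0, -gtau, 1] := by
    rw [icoQuintic_mulVec]; ext i; fin_cases i <;> simp <;> grind
  have hQ4 : icoQuintic *ᵥ ![0, -gtau, 1] = ![gtau, -1, 0] := by
    rw [icoQuintic_mulVec]; ext i; fin_cases i <;> simp <;> grind
  have hfix : ∀ k : ℕ, icoQuintic ^ k *ᵥ ![1, 0, gtau] = ![1, 0, gtau] := by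
    intro k
    induction k with
    | zero => simp
    | succ k ih => rw [pow_succ, ← mulVec_mulVec, hQ0, ih]
  suffices h : ∃ k : ℕ, icoQuintic ^ k *ᵥ ![gtau, 1, 0] = u by
    obtain ⟨k, hk⟩ := h
    exact ⟨_, pow_mem icoQuintic_mem k, hfix k, hk⟩
  obtain ⟨s, t, rfl | rfl, rfl | rfl, rfl | rfl | rfl⟩ := hu <;>
    simp [dotProduct, Fin.sum_univ_three] at hd <;> try (exfalso; nlinarith)
  · exact ⟨1, by simp [hQ1]⟩
  · exact ⟨0, by simp⟩
  · exact ⟨4, by simp [pow_succ, ← mulVec_mulVec, hQ1, hQ2, hQ3, hQ4]⟩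
  · exact ⟨3, by simp [pow_succ, ← mulVec_mulVec, hQ1, hQ2, hQ3]⟩
  · exact ⟨2, by simp [pow_succ, ← mulVec_mulVec, hQ1, hQ2]⟩

lemma stabSO3_AIco : stabSO3 AIco = IcoSet := by
  refine Set.Subset.antisymm (fun A hA => ?_) fun A hA => icoSubmonoid_subset_stab hA
  have hv0 : ![1, 0, gtau] ∈ IcoVerts := ⟨1, 1, by simp, by simp, by simp⟩
  have hv1 : ![gtau, 1, 0] ∈ IcoVerts := ⟨1, 1, by simp, by simp, by simp⟩
  obtain ⟨h, hh, e⟩ := exists_mem_icoSubmonoid_mulVec_eq (mulVec_mem_icoVerts hA hv0)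
  have hs := icoSubmonoid_subset_stab hh
  have hB := mul_mem_stabSO3_AIco (transpose_mem_stabSO3_AIco hs) hA
  have e0 : (hᵀ * A) *ᵥ ![1, 0, gtau] = ![1, 0, gtau] := by
    rw [← mulVec_mulVec, ← e, mulVec_mulVec, SO3.transpose_mul_self hs.1, one_mulVec]
  obtain ⟨g, hg, g0, g1⟩ := exists_mem_icoSubmonoid_mulVec_adjacent
    (mulVec_mem_icoVerts hB hv1) (by
      have hd := SO3.dotProduct_mulVec_mulVec hB.1 ![gtau, 1, 0] ![1, 0, gtau]
      rw [e0] at hd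
      exact hd.trans (by simp [dotProduct, Fin.sum_univ_three]))
  have hgB : g = hᵀ * A :=
    SO3.ext_of_adjacent (icoSubmonoid_subset_stab hg).1 hB.1 (g0.trans e0.symm) g1
  have hA' : A = h * g := by rw [hgB, ← mul_assoc, hs.1.1, one_mul]
  rw [hA', ← coe_icoSubmonoid]
  exact mul_mem hh hg

/-- The vertices of the dodecahedron, indexed by ordered pairs of distinct elements of `Fin 5`,
each standing for an inscribed cube; the diagonal entries are zero. -/
def dodecaVert (i j : Fin 5) : Fin 3 → ℝ :=
  (![![![0, 0, 0], ![gtau - 1, gtau, 0], ![-gtau, 0, 1 - gtau], ![0, 1 - gtau, gtau], ![1, -1, -1]],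
    ![![1 - gtau, -gtau, 0], ![0, 0, 0], ![0, gtau - 1, gtau], ![gtau, 0, 1 - gtau], ![-1, 1, -1]],
    ![![gtau, 0, gtau - 1], ![0, 1 - gtau, -gtau], ![0, 0, 0], ![1 - gtau, gtau, 0], ![-1, -1, 1]],
    ![![0, gtau - 1, -gtau], ![-gtau, 0, gtau - 1], ![gtau - 1, -gtau, 0], ![0, 0, 0], ![1, 1, 1]],
    ![![-1, 1, 1], ![1, -1, 1], ![1, 1, -1], ![-1, -1, -1], ![0, 0, 0]]] :
      Fin 5 → Fin 5 → Fin 3 → ℝ) i j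

/-- The even permutation induced by `icoHalfTurn`. -/
def permHalfTurn : alternatingGroup (Fin 5) := ⟨c[0, 1] * c[2, 3],
  Equiv.Perm.mem_alternatingGroup.2 (by decide)⟩

/-- The even permutation induced by `icoCycle`. -/
def permCycle : alternatingGroup (Fin 5) := ⟨c[0, 1, 2],
  Equiv.Perm.mem_alternatingGroup.2 (by decide)⟩

/-- The even permutation induced by `icoQuintic`. -/
def permQuintic : alternatingGroup (Fin 5) := ⟨c[0, 4, 2, 3, 1],
  Equiv.Perm.mem_alternatingGroup.2 (by decide)⟩

lemma nat_card_alternatingGroup_five : Nat.card (alternatingGroup (Fin 5)) = 60 := by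
  rw [Nat.card_eq_fintype_card, card_alternatingGroup]
  simp [Nat.factorial]

lemma alternatingGroup_five_eq_top {H : Subgroup (alternatingGroup (Fin 5))}
    (h2 : 2 ∣ Nat.card H) (h3 : 3 ∣ Nat.card H) (h5 : 5 ∣ Nat.card H) : H = ⊤ := by
  have hmul := H.card_mul_index
  have h30 : 30 ∣ Nat.card H := by omega
  obtain ⟨k, hk⟩ := h30
  rw [hk, nat_card_alternatingGroup_five] at hmul
  have hki : k * H.index = 2 := by linarith
  have : H.index = 1 ∨ H.index = 2 := by
    have := Nat.le_of_dvd two_pos (Dvd.intro_left _ hki)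
    have : H.index ≠ 0 := by rintro h; simp [h] at hki
    omega
  rcases this with h | h
  · exact Subgroup.index_eq_one.1 h
  · have hn := Subgroup.normal_of_index_eq_two h
    rcases hn.eq_bot_or_eq_top with h | h
    · simp [h] at h5
    · exact h

lemma closure_perm_eq_top :
    Submonoid.closure ({permHalfTurn, permCycle, permQuintic} : Set (alternatingGroup (Fin 5))) =
      ⊤ := by
  set H := Subgroup.closure
    ({permHalfTurn, permCycle, permQuintic} : Set (alternatingGroup (Fin 5))) with hH
  have key : ∀ σ ∈ ({permHalfTurn, permCycle, permQuintic} : Set (alternatingGroup (Fin 5))),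
      orderOf σ ∣ Nat.card H :=
    fun σ hσ => Subgroup.orderOf_dvd_natCard _ (Subgroup.subset_closure hσ)
  have h2 : orderOf permHalfTurn = 2 := orderOf_eq_prime (by decide) (by decide)
  have h3 : orderOf permCycle = 3 := orderOf_eq_prime (by decide) (by decide)
  have : Fact (Nat.Prime 5) := ⟨Nat.prime_five⟩
  have h5 : orderOf permQuintic = 5 :=
    orderOf_eq_prime (Subtype.ext (Equiv.ext (by decide))) (by decide)
  have htop : H = ⊤ := alternatingGroup_five_eq_top
    (h2.symm.dvd.trans (key permHalfTurn (by simp)))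
    (h3.symm.dvd.trans (key permCycle (by simp))) (h5.symm.dvd.trans (key permQuintic (by simp)))
  rw [← Subgroup.closure_toSubmonoid_of_finite, ← hH, htop, Subgroup.top_toSubmonoid]

/-- The rotation `g` acts on the dodecahedron as the permutation `σ` of the cubes. -/
def Induces (g : Matrix (Fin 3) (Fin 3) ℝ) (σ : alternatingGroup (Fin 5)) : Prop :=
  ∀ i j, g *ᵥ dodecaVert i j = dodecaVert (σ.1 i) (σ.1 j)

lemma Induces.mul {g h : Matrix (Fin 3) (Fin 3) ℝ} {σ ρ : alternatingGroup (Fin 5)}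
    (hg : Induces g σ) (hh : Induces h ρ) : Induces (g * h) (σ * ρ) := by
  intro i j
  rw [← mulVec_mulVec, hh, hg]
  rfl

lemma induces_one : Induces 1 1 := fun i j => by simp

lemma induces_halfTurn : Induces icoHalfTurn permHalfTurn := by
  have e : ⇑permHalfTurn.1 = ![1, 0, 3, 2, 4] := by decide
  intro i j
  rw [e]
  fin_cases i <;> fin_cases j <;> simp [dodecaVert, icoHalfTurn_mulVec]

lemma induces_cycle : Induces icoCycle permCycle := by
  have e : ⇑permCycle.1 = ![1, 2, 0, 3, 4] := by decide
  intro i j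
  rw [e]
  fin_cases i <;> fin_cases j <;> simp [dodecaVert, icoCycle_mulVec]

lemma induces_quintic : Induces icoQuintic permQuintic := by
  have ht := gtau_sq
  have e : ⇑permQuintic.1 = ![4, 0, 3, 1, 2] := by decide
  intro i j
  rw [e]
  fin_cases i <;> fin_cases j <;> simp [dodecaVert, icoQuintic_mulVec] <;> grind

lemma Induces.left_unique {g h : Matrix (Fin 3) (Fin 3) ℝ} {σ : alternatingGroup (Fin 5)}
    (hg : Induces g σ) (hh : Induces h σ) : g = h := by
  have k : ∀ i j, g *ᵥ dodecaVert i j = h *ᵥ dodecaVert i j := fun i j =>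
    (hg i j).trans (hh i j).symm
  ext i j
  have e0 := congrFun (k 3 4) i
  have e1 := congrFun (k 0 4) i
  have e2 := congrFun (k 1 4) i
  have e3 := congrFun (k 2 4) i
  simp [dodecaVert, mulVec, dotProduct, Fin.sum_univ_three] at e0 e1 e2 e3
  fin_cases j <;> simp <;> linarith

lemma fst_eq_of_dodecaVert_eq {i k l : Fin 5} (hi : i ≠ 4)
    (h : dodecaVert i 4 = dodecaVert k l) : k = i := by
  fin_cases i <;> fin_cases k <;> first | rfl | exact absurd rfl hi |
    (exfalso; fin_cases l <;> simp [dodecaVert] at h <;> norm_num at h)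

lemma eq_one_of_induces_one {σ : alternatingGroup (Fin 5)} (h : Induces 1 σ) : σ = 1 := by
  have hfix : ∀ i ≠ 4, σ.1 i = i := fun i hi =>
    fst_eq_of_dodecaVert_eq hi (by simpa using h i 4)
  ext i : 2
  by_cases hi : i = 4
  · subst hi
    by_contra h4
    exact h4 (σ.1.injective (hfix _ h4))
  · exact hfix i hi

lemma exists_induces (σ : alternatingGroup (Fin 5)) : ∃ g ∈ icoSubmonoid, Induces g σ := by
  have hσ : σ ∈ Submonoid.closure
      ({permHalfTurn, permCycle, permQuintic} : Set (alternatingGroup (Fin 5))) := by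
    rw [closure_perm_eq_top]; trivial
  induction hσ using Submonoid.closure_induction with
  | mem σ h =>
    rcases h with rfl | rfl | rfl
    exacts [⟨_, icoHalfTurn_mem, induces_halfTurn⟩, ⟨_, icoCycle_mem, induces_cycle⟩,
      ⟨_, icoQuintic_mem, induces_quintic⟩]
  | one => exact ⟨1, one_mem _, induces_one⟩
  | mul σ ρ _ _ h k =>
    obtain ⟨g, hg, h⟩ := h
    obtain ⟨g', hg', k⟩ := k
    exact ⟨_, mul_mem hg hg', h.mul k⟩

lemma exists_induces_of_mem {g : Matrix (Fin 3) (Fin 3) ℝ} (hg : g ∈ icoSubmonoid) :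
    ∃ σ, Induces g σ := by
  induction hg using Submonoid.closure_induction with
  | mem g h =>
    rcases h with rfl | rfl | rfl
    exacts [⟨_, induces_halfTurn⟩, ⟨_, induces_cycle⟩, ⟨_, induces_quintic⟩]
  | one => exact ⟨1, induces_one⟩
  | mul g h _ _ hg hh =>
    obtain ⟨σ, hσ⟩ := hg
    obtain ⟨ρ, hρ⟩ := hh
    exact ⟨_, hσ.mul hρ⟩

lemma setIsoGroup_icoSet : SetIsoGroup IcoSet (alternatingGroup (Fin 5)) := by
  choose f hf hfi using exists_induces
  refine ⟨f, fun σ ρ h => ?_,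
    fun σ ρ => (hfi _).left_unique ((hfi σ).mul (hfi ρ)), Set.Subset.antisymm ?_ fun g hg => ?_⟩
  · have e : f ρ * f ρ⁻¹ = 1 :=
      ((hfi ρ).mul (hfi ρ⁻¹)).left_unique (by rw [mul_inv_cancel]; exact induces_one)
    have := (hfi σ).mul (hfi ρ⁻¹)
    rw [h, e] at this
    exact mul_inv_eq_one.1 (eq_one_of_induces_one this)
  · rintro _ ⟨σ, rfl⟩
    exact hf σ
  · obtain ⟨σ, hσ⟩ := exists_induces_of_mem hg
    exact ⟨σ, (hfi σ).left_unique hσ⟩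

lemma SetIsoGroup.ncard_eq {M : Type*} [Monoid M] {S : Set M} {G : Type*} [Group G]
    (h : SetIsoGroup S G) : S.ncard = Nat.card G := by
  obtain ⟨f, hf, -, rfl⟩ := h
  rw [← Set.image_univ, Set.ncard_image_of_injective _ hf, Set.ncard_univ]

/-- `A_Ico` is an associative 3-plane, its `SO(3)`-stabiliser equals `Ico`,
and `Ico` is isomorphic to the alternating group `A₅`; in particular it has order 60. -/
theorem stmt4 :
    IsAssocSubspace AIco ∧
    stabSO3 AIco = IcoSet ∧
    SetIsoGroup IcoSet ↥(alternatingGroup (Fin 5)) ∧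
    IcoSet.ncard = 60 := by
  refine ⟨isAssocSubspace_AIco, stabSO3_AIco, setIsoGroup_icoSet, ?_⟩
  rw [setIsoGroup_icoSet.ncard_eq, nat_card_alternatingGroup_five]
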